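/- arXiv:2604.09931 — 2 statements merged into one kernel-verified Lean document; each statement's English description precedes it below -/
import Mathlib

section
/- Cost recovery under optimally tuned step size (Theorem 2, per-generator form): Let C > 0, c ∈ ℝ, p̄ ≥ 0, λ ∈ ℝ and g ∈ ℝ be real numbers, and let the updated generation be g⁺ = max(0, min(p̄, g + C⁻¹·(λ − C·g − c))), i.e., the real-time generation update with step size η = C⁻¹. Then the generator's profit at the updated generation is nonnegative: λ·g⁺ − ((1/2)·C·(g⁺)² + c·g⁺) ≥ 0. -/
/-- Cost recovery under optimally tuned step size (Theorem 2, per-generator form):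
with step size η = C⁻¹, the generator's profit at the updated generation is nonnegative. -/
theorem cost_recovery_optimal_step
    (C c pbar lam g : ℝ) (hC : 0 < C) (hpbar : 0 ≤ pbar)
    (gplus : ℝ) (hgplus : gplus = max 0 (min pbar (g + C⁻¹ * (lam - C * g - c)))) :
    lam * gplus - ((1 / 2) * C * gplus ^ 2 + c * gplus) ≥ 0 := by
  have hstep : C * (g + C⁻¹ * (lam - C * g - c)) = lam - c := by
    field_simp
    ring
  rcases max_choice 0 (min pbar (g + C⁻¹ * (lam - C * g - c))) with h | h
  · rw [hgplus, h]
    simp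
  · have hnonneg : 0 ≤ gplus := hgplus ▸ le_max_left _ _
    have hle : gplus ≤ g + C⁻¹ * (lam - C * g - c) := by
      rw [hgplus, h]
      exact min_le_right _ _
    have hmarginal : C * gplus ≤ lam - c := hstep ▸ mul_le_mul_of_nonneg_left hle hC.le
    nlinarith [mul_nonneg hnonneg (sub_nonneg.2 hmarginal), mul_nonneg hC.le (sq_nonneg gplus)]
end

section
/- General-step profit lower bound (inequality (15)): Let C > 0, c ∈ ℝ, p̄ ≥ 0, λ ∈ ℝ, g ∈ ℝ and η > 0 be real numbers, and let g⁺ = max(0, min(p̄, g + η·(λ − C·g − c))) be the real-time generation update. Then λ·g⁺ − (1/2)·C·(g⁺)² − c·g⁺ ≥ −(1/η)·g·g⁺ + C·g·g⁺ + (1/(2η))·(g⁺)² − (1/2)·C·(g⁺)². -/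
/-- General-step profit lower bound (inequality (15)). -/
theorem general_step_profit_lower_bound
    (C c pbar lam g eta : ℝ) (hC : 0 < C) (hpbar : 0 ≤ pbar) (heta : 0 < eta)
    (gplus : ℝ) (hgplus : gplus = max 0 (min pbar (g + eta * (lam - C * g - c)))) :
    lam * gplus - (1 / 2) * C * gplus ^ 2 - c * gplus ≥
      -(1 / eta) * g * gplus + C * g * gplus + (1 / (2 * eta)) * gplus ^ 2 -
        (1 / 2) * C * gplus ^ 2 := by
  set y := g + eta * (lam - C * g - c) with hy
  have hnonneg : 0 ≤ gplus := hgplus ▸ le_max_left _ _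
  have hprod : 0 ≤ gplus * (y - gplus / 2) := by
    rcases hnonneg.eq_or_lt with h | h
    · simp [← h]
    · have hle : gplus ≤ y := by
        rcases le_max_iff.mp hgplus.le with h0 | h0
        · linarith
        · exact h0.trans (min_le_right _ _)
      exact mul_nonneg hnonneg (by linarith)
  have hdiff : lam * gplus - (1 / 2) * C * gplus ^ 2 - c * gplus -
      (-(1 / eta) * g * gplus + C * g * gplus + (1 / (2 * eta)) * gplus ^ 2 -
        (1 / 2) * C * gplus ^ 2) = gplus * (y - gplus / 2) / eta := by
    rw [hy]
    field_simp
    ring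
  have hquot := div_nonneg hprod heta.le
  linarith
end
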